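/- For given (v, n, ε), let (Q, \hat P_n) and (Q', \hat P'_n) be block design schemes with parameters (v,b,r,k,λ,ε) and (v,b',r',k',λ',ε), respectively. Then the two schemes are marginally equivalent if and only if k = k'. -/

import Mathlib

open Finset Real
open scoped Classical

noncomputable section

/-- The "row" of an incidence structure: outputs incident to input `x`. -/
def Ix {v : ℕ} {Y : Type*} [Fintype Y] [DecidableEq Y]
    (I : Finset (Fin v × Y)) (x : Fin v) : Finset Y :=
  Finset.univ.filter (fun y => (x, y) ∈ I)

/-- The "column" of an incidence structure: inputs incident to output `y`. -/
def Iy {v : ℕ} {Y : Type*} [Fintype Y] [DecidableEq Y]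
    (I : Finset (Fin v × Y)) (y : Y) : Finset (Fin v) :=
  Finset.univ.filter (fun x => (x, y) ∈ I)

/-- A `(v,b,r,lam)`-regular pairwise-balanced design (RPBD). -/
def IsRPBD {v : ℕ} {Y : Type*} [Fintype Y] [DecidableEq Y]
    (I : Finset (Fin v × Y)) (b r lam : ℕ) : Prop :=
  0 < v ∧ Fintype.card Y = b ∧ lam < r ∧ r < b ∧
    (∀ x : Fin v, (Ix I x).card = r) ∧
    (∀ x x' : Fin v, x ≠ x' → (Ix I x ∩ Ix I x').card = lam)

/-- A `(v,b,r,k,lam)`-block design: an RPBD that is moreover `k`-uniform, with `0 < k < v`. -/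
def IsBlockDesign {v : ℕ} {Y : Type*} [Fintype Y] [DecidableEq Y]
    (I : Finset (Fin v × Y)) (b r k lam : ℕ) : Prop :=
  IsRPBD I b r lam ∧ 0 < k ∧ k < v ∧ ∀ y : Y, (Iy I y).card = k

/-- The (block design / RPBD) privacy mechanism: output `y` has probability `α e^ε` if
`(x,y) ∈ I` and `α` otherwise, where `α = 1/(r e^ε + b - r)`. -/
def mechQ {v : ℕ} {Y : Type*} [Fintype Y] [DecidableEq Y]
    (I : Finset (Fin v × Y)) (b r : ℕ) (ε : ℝ) (x : Fin v) (y : Y) : ℝ :=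
  if (x, y) ∈ I then Real.exp ε / ((r : ℝ) * Real.exp ε + (b : ℝ) - (r : ℝ))
  else 1 / ((r : ℝ) * Real.exp ε + (b : ℝ) - (r : ℝ))

/-- The probability simplex `Δ_v` on `{1,…,v}`. -/
def simplex (v : ℕ) : Set (Fin v → ℝ) :=
  {P | (∀ x, 0 ≤ P x) ∧ ∑ x, P x = 1}

/-- Marginal distribution of a single privatized output `Y` when `X ~ P`, `Y ~ Q(·|X)`. -/
def outDist {v : ℕ} {Y : Type*} [Fintype Y] (P : Fin v → ℝ) (Q : Fin v → Y → ℝ) (y : Y) : ℝ :=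
  ∑ x, P x * Q x y

/-- Joint probability of the i.i.d. outputs `(Y_1,…,Y_n)`. -/
def jointW {v n : ℕ} {Y : Type*} [Fintype Y] (P : Fin v → ℝ) (Q : Fin v → Y → ℝ)
    (ys : Fin n → Y) : ℝ :=
  ∏ i, outDist P Q (ys i)

/-- The count `N_x(Y_1,…,Y_n) = Σ_i 1(Y_i ∈ ℐ_x)`. -/
def Nx {v n : ℕ} {Y : Type*} [Fintype Y] [DecidableEq Y]
    (I : Finset (Fin v × Y)) (x : Fin v) (ys : Fin n → Y) : ℕ :=
  (Finset.univ.filter (fun i => ys i ∈ Ix I x)).card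

/-- The canonical (unbiased) estimator of an RPBD scheme. -/
def canonEst {v n : ℕ} {Y : Type*} [Fintype Y] [DecidableEq Y]
    (I : Finset (Fin v × Y)) (b r lam : ℕ) (ε : ℝ) (x : Fin v) (ys : Fin n → Y) : ℝ :=
  (1 / (((r : ℝ) - (lam : ℝ)) * (Real.exp ε - 1))) *
    ((Nx I x ys : ℝ) * ((r : ℝ) * Real.exp ε + (b : ℝ) - (r : ℝ)) / (n : ℝ)
      - ((lam : ℝ) * Real.exp ε + ((r : ℝ) - (lam : ℝ))))

/-- The squared `ℓ_2` loss. -/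
def l2loss (v : ℕ) (p phat : Fin v → ℝ) : ℝ := ∑ x, (p x - phat x) ^ 2

/-- The risk `R_{v,n}(ℓ, P, Q, P̂_n) = E[ℓ(P, P̂_n(Y_1,…,Y_n))]`. -/
def risk {v : ℕ} {Y : Type*} [Fintype Y] (n : ℕ) (P : Fin v → ℝ) (Q : Fin v → Y → ℝ)
    (L : (Fin v → ℝ) → (Fin v → ℝ) → ℝ) (est : Fin v → (Fin n → Y) → ℝ) : ℝ :=
  ∑ ys : Fin n → Y, jointW P Q ys * L P (fun x => est x ys)

/-- Marginal equivalence of two schemes: for every `P ∈ Δ_v` and coordinate `x`, the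
estimators `P̂_{n,x}` and `P̂'_{n,x}` have the same distribution. -/
def MargEquiv {v : ℕ} {Y Y' : Type*} [Fintype Y] [Fintype Y'] (n : ℕ)
    (Q : Fin v → Y → ℝ) (est : Fin v → (Fin n → Y) → ℝ)
    (Q' : Fin v → Y' → ℝ) (est' : Fin v → (Fin n → Y') → ℝ) : Prop :=
  ∀ P ∈ simplex v, ∀ x : Fin v, ∀ t : ℝ,
    (∑ ys : Fin n → Y, if est x ys = t then jointW P Q ys else 0)
      = ∑ ys : Fin n → Y', if est' x ys = t then jointW P Q' ys else 0

/-- The normalizing constant `r e^ε + b - r` of a block design mechanism. -/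
def mechNorm (b r : ℕ) (ε : ℝ) : ℝ := (r : ℝ) * Real.exp ε + (b : ℝ) - (r : ℝ)

/-- The slope of the affine map `P x ↦ ℙ(Y ∈ Ix I x)`. -/
def hitSlope (b r lam : ℕ) (ε : ℝ) : ℝ :=
  ((r : ℝ) - lam) * (Real.exp ε - 1) / mechNorm b r ε

/-- The intercept of the affine map `P x ↦ ℙ(Y ∈ Ix I x)`. -/
def hitIntercept (b r lam : ℕ) (ε : ℝ) : ℝ :=
  ((lam : ℝ) * Real.exp ε + ((r : ℝ) - lam)) / mechNorm b r ε

section Counting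

variable {v b r k lam : ℕ} {Y : Type*} [Fintype Y] [DecidableEq Y] {I : Finset (Fin v × Y)}

theorem sum_card_Ix_inter (S : Finset Y) :
    ∑ x, (S ∩ Ix I x).card = ∑ y ∈ S, (Iy I y).card := by
  have hx (x : Fin v) : (S ∩ Ix I x).card = ∑ y ∈ S, if (x, y) ∈ I then 1 else 0 := by
    rw [← Finset.card_filter]
    congr 1
    ext y
    simp [Ix]
  have hy (y : Y) : (Iy I y).card = ∑ x, if (x, y) ∈ I then 1 else 0 := by
    rw [← Finset.card_filter, Iy]
  simp only [hx, hy]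
  exact Finset.sum_comm

theorem IsBlockDesign.mul_eq_mul (h : IsBlockDesign I b r k lam) : v * r = b * k := by
  obtain ⟨⟨-, hb, -, -, hr, -⟩, -, -, hk⟩ := h
  simpa [hr, hk, hb] using sum_card_Ix_inter (I := I) Finset.univ

theorem IsBlockDesign.add_pairs_eq (h : IsBlockDesign I b r k lam) :
    (r : ℝ) + lam * ((v : ℝ) - 1) = r * k := by
  obtain ⟨⟨hv, -, -, -, hr, hl⟩, -, -, hk⟩ := h
  have key := sum_card_Ix_inter (I := I) (Ix I ⟨0, hv⟩)
  rw [← Finset.add_sum_erase _ _ (Finset.mem_univ (⟨0, hv⟩ : Fin v)),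
    Finset.sum_congr rfl (g := fun _ => lam)
      (fun x hx => hl _ x (Finset.ne_of_mem_erase hx).symm)] at key
  simp only [Finset.inter_self, hr, hk, Finset.sum_const, smul_eq_mul,
    Finset.card_erase_of_mem (Finset.mem_univ _), Finset.card_univ, Fintype.card_fin] at key
  have := congrArg (Nat.cast (R := ℝ)) key
  push_cast [Nat.cast_sub (show 1 ≤ v from hv)] at this
  linarith

end Counting

section Parameters

variable {v b r k lam : ℕ} {Y : Type*} [Fintype Y] [DecidableEq Y] {I : Finset (Fin v × Y)}
  {ε : ℝ}

theorem mechNorm_pos (h : IsRPBD I b r lam) : 0 < mechNorm b r ε := by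
  obtain ⟨-, -, -, hrb, -, -⟩ := h
  have h1 : (r : ℝ) < b := by exact_mod_cast hrb
  have h2 : 0 ≤ (r : ℝ) * Real.exp ε := by positivity
  unfold mechNorm
  linarith

theorem hitSlope_pos (h : IsRPBD I b r lam) (hε : 0 < ε) : 0 < hitSlope b r lam ε := by
  have h1 : (lam : ℝ) < r := by exact_mod_cast h.2.2.1
  have h2 : 1 < Real.exp ε := Real.one_lt_exp_iff.2 hε
  exact div_pos (mul_pos (by linarith) (by linarith)) (mechNorm_pos h)

theorem hitSlope_add_mul_hitIntercept (h : IsBlockDesign I b r k lam) :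
    hitSlope b r lam ε + v * hitIntercept b r lam ε = k := by
  have hc := (mechNorm_pos (ε := ε) h.1).ne'
  have h1 : (v : ℝ) * r = b * k := by exact_mod_cast h.mul_eq_mul
  have h2 := h.add_pairs_eq
  unfold hitSlope hitIntercept
  field_simp
  unfold mechNorm
  linear_combination (Real.exp ε - 1) * h2 + h1

theorem hitSlope_eq (h : IsBlockDesign I b r k lam) (hε : 0 < ε) :
    hitSlope b r lam ε =
      k * (v - k) * (Real.exp ε - 1) / ((v - 1) * (k * (Real.exp ε - 1) + v)) := by
  have hc := (mechNorm_pos (ε := ε) h.1).ne'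
  have h1 : (v : ℝ) * r = b * k := by exact_mod_cast h.mul_eq_mul
  have h2 := h.add_pairs_eq
  have hk : (1 : ℝ) ≤ k := by exact_mod_cast h.2.1
  have hkv : (k : ℝ) < v := by exact_mod_cast h.2.2.1
  have he : 0 < Real.exp ε - 1 := by linarith [Real.one_lt_exp_iff.2 hε]
  have hv : 0 < (v : ℝ) - 1 := by linarith
  have hd : 0 < (v - 1) * (k * (Real.exp ε - 1) + v) := by
    have := mul_pos (show (0 : ℝ) < k by linarith) he
    exact mul_pos hv (by linarith)
  rw [hitSlope, div_eq_div_iff hc hd.ne', mechNorm]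
  have h3 : ((r : ℝ) - lam) * (v - 1) = r * (v - k) := by linear_combination -h2
  linear_combination (Real.exp ε - 1) * (k * (Real.exp ε - 1) + v) * h3
    + (Real.exp ε - 1) * (v - k) * h1

theorem canonEst_eq {n : ℕ} (h : IsRPBD I b r lam) (hε : 0 < ε) (x : Fin v) (ys : Fin n → Y) :
    canonEst I b r lam ε x ys =
      ((Nx I x ys : ℝ) / n - hitIntercept b r lam ε) / hitSlope b r lam ε := by
  have hc := (mechNorm_pos (ε := ε) h).ne'
  have h1 : (r : ℝ) - lam ≠ 0 := (sub_pos.2 (by exact_mod_cast h.2.2.1)).ne'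
  have h2 : Real.exp ε - 1 ≠ 0 := (sub_pos.2 (Real.one_lt_exp_iff.2 hε)).ne'
  rw [canonEst, hitIntercept, hitSlope, ← mechNorm]
  field_simp

end Parameters

section Distribution

variable {v n b r k lam : ℕ} {Y : Type*} [Fintype Y] [DecidableEq Y] {I : Finset (Fin v × Y)}
  {ε : ℝ} {P : Fin v → ℝ}

/-- The number of independent draws landing in `S` has a law depending only on the
probability `∑ y ∈ S, p y` of a single hit. -/
theorem sum_card_filter_mem_mul_prod (p : Y → ℝ) (hp : ∑ y, p y = 1) (S : Finset Y)
    (f : ℕ → ℝ) :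
    ∑ ys : Fin n → Y, f (Finset.univ.filter (fun i => ys i ∈ S)).card * ∏ i, p (ys i) =
      ∑ T : Finset (Fin n), f T.card *
        ∏ i, if i ∈ T then ∑ y ∈ S, p y else 1 - ∑ y ∈ S, p y := by
  have hT (T : Finset (Fin n)) :
      (∏ i, if i ∈ T then ∑ y ∈ S, p y else 1 - ∑ y ∈ S, p y) =
        ∑ ys : Fin n → Y,
          if Finset.univ.filter (fun i => ys i ∈ S) = T then ∏ i, p (ys i) else 0 := by
    have hi (i : Fin n) : (if i ∈ T then ∑ y ∈ S, p y else 1 - ∑ y ∈ S, p y) =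
        ∑ y, if (y ∈ S ↔ i ∈ T) then p y else 0 := by
      split_ifs with hiT
      · simp [hiT]
      · rw [← hp, ← Finset.sum_compl_add_sum S, add_sub_cancel_right, ← Finset.sum_filter]
        congr 1
        ext y
        simp [hiT]
    simp only [hi]
    rw [Finset.prod_univ_sum, Fintype.piFinset_univ]
    refine Finset.sum_congr rfl fun ys _ => ?_
    split_ifs with hys
    · exact Finset.prod_congr rfl fun i _ => if_pos (by simp [← hys])
    · obtain ⟨i, hi⟩ : ∃ i, ¬(ys i ∈ S ↔ i ∈ T) := by
        simpa [Finset.ext_iff] using hys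
      exact Finset.prod_eq_zero (Finset.mem_univ i) (if_neg hi)
  simp only [hT, Finset.mul_sum]
  rw [Finset.sum_comm]
  refine Finset.sum_congr rfl fun ys _ => ?_
  simp

theorem sum_mechQ (x : Fin v) (S : Finset Y) :
    ∑ y ∈ S, mechQ I b r ε x y =
      ((S ∩ Ix I x).card * (Real.exp ε - 1) + S.card) / mechNorm b r ε := by
  have hy (y : Y) : mechQ I b r ε x y =
      ((if y ∈ Ix I x then 1 else 0) * (Real.exp ε - 1) + 1) / mechNorm b r ε := by
    by_cases hxy : (x, y) ∈ I <;> simp [mechQ, mechNorm, Ix, hxy]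
  simp only [hy, ← Finset.sum_div, Finset.sum_add_distrib, ← Finset.sum_mul]
  simp

theorem sum_outDist (h : IsRPBD I b r lam) (hP : P ∈ simplex v) :
    ∑ y, outDist P (mechQ I b r ε) y = 1 := by
  have hc := (mechNorm_pos (ε := ε) h).ne'
  have hx (x : Fin v) : ∑ y, mechQ I b r ε x y = 1 := by
    rw [sum_mechQ, Finset.univ_inter, h.2.2.2.2.1, Finset.card_univ, h.2.1,
      div_eq_one_iff_eq hc, mechNorm]
    ring
  simp only [outDist]
  rw [Finset.sum_comm]
  simp only [← Finset.mul_sum, hx, mul_one]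
  exact hP.2

theorem sum_outDist_Ix (h : IsRPBD I b r lam) (hP : P ∈ simplex v) (x : Fin v) :
    ∑ y ∈ Ix I x, outDist P (mechQ I b r ε) y =
      hitSlope b r lam ε * P x + hitIntercept b r lam ε := by
  have hx' (x' : Fin v) : ∑ y ∈ Ix I x, mechQ I b r ε x' y =
      (if x = x' then hitSlope b r lam ε else 0) + hitIntercept b r lam ε := by
    rw [sum_mechQ, h.2.2.2.2.1]
    split_ifs with hxx
    · rw [← hxx, Finset.inter_self, h.2.2.2.2.1, hitSlope, hitIntercept]
      ring
    · rw [h.2.2.2.2.2 _ _ hxx, hitIntercept]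
      ring
  simp only [outDist]
  rw [Finset.sum_comm]
  simp only [← Finset.mul_sum, hx', mul_add, Finset.sum_add_distrib, ← Finset.sum_mul, hP.2]
  simp [mul_comm]

theorem outDist_mechQ_pos (h : IsRPBD I b r lam) (hP : P ∈ simplex v) (y : Y) :
    0 < outDist P (mechQ I b r ε) y := by
  have hQ (x : Fin v) : 0 < mechQ I b r ε x y := by
    have hc : 0 < (r : ℝ) * Real.exp ε + b - r := mechNorm_pos (ε := ε) h
    unfold mechQ
    split_ifs <;> positivity
  obtain ⟨x, -, hx⟩ : ∃ x ∈ Finset.univ, P x ≠ 0 :=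
    Finset.exists_ne_zero_of_sum_ne_zero (by rw [hP.2]; exact one_ne_zero)
  exact Finset.sum_pos' (fun x _ => mul_nonneg (hP.1 x) (hQ x).le)
    ⟨x, Finset.mem_univ x, mul_pos ((hP.1 x).lt_of_ne' hx) (hQ x)⟩

theorem law_canonEst (h : IsRPBD I b r lam) (hε : 0 < ε) (hP : P ∈ simplex v) (x : Fin v)
    (t : ℝ) :
    (∑ ys : Fin n → Y,
        if canonEst I b r lam ε x ys = t then jointW P (mechQ I b r ε) ys else 0) =
      ∑ T : Finset (Fin n),
        (if ((T.card : ℝ) / n - hitIntercept b r lam ε) / hitSlope b r lam ε = t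
          then 1 else 0) *
        ∏ i, if i ∈ T then hitSlope b r lam ε * P x + hitIntercept b r lam ε
          else 1 - (hitSlope b r lam ε * P x + hitIntercept b r lam ε) := by
  rw [← sum_outDist_Ix h hP x]
  rw [← sum_card_filter_mem_mul_prod _ (sum_outDist h hP) (Ix I x) (fun j : ℕ =>
    if ((j : ℝ) / n - hitIntercept b r lam ε) / hitSlope b r lam ε = t then (1 : ℝ) else 0)]
  simp only [canonEst_eq h hε, Nx, jointW, ite_mul, one_mul, zero_mul]

theorem law_canonEst_ne_zero_iff (h : IsRPBD I b r lam) (hP : P ∈ simplex v) (x : Fin v)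
    (t : ℝ) :
    (∑ ys : Fin n → Y,
        if canonEst I b r lam ε x ys = t then jointW P (mechQ I b r ε) ys else 0) ≠ 0 ↔
      t ∈ Set.range (canonEst (n := n) I b r lam ε x) := by
  have hpos (ys : Fin n → Y) : 0 < jointW P (mechQ I b r ε) ys :=
    Finset.prod_pos fun i _ => outDist_mechQ_pos h hP (ys i)
  have hnn (ys : Fin n → Y) :
      0 ≤ if canonEst I b r lam ε x ys = t then jointW P (mechQ I b r ε) ys else 0 := by
    split_ifs
    exacts [(hpos ys).le, le_rfl]
  rw [Ne, Finset.sum_eq_zero_iff_of_nonneg fun ys _ => hnn ys]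
  simp [(hpos _).ne']

theorem isLeast_range_canonEst (h : IsRPBD I b r lam) (hε : 0 < ε) (x : Fin v) :
    IsLeast (Set.range (canonEst (n := n) I b r lam ε x))
      (-hitIntercept b r lam ε / hitSlope b r lam ε) := by
  have hA := hitSlope_pos h hε
  constructor
  · obtain ⟨y, hy⟩ : ∃ y, y ∉ Ix I x := by
      by_contra! hall
      have h1 := h.2.2.2.2.1 x
      rw [Finset.eq_univ_iff_forall.2 hall, Finset.card_univ, h.2.1] at h1
      exact h.2.2.2.1.ne' h1
    exact ⟨fun _ => y, by simp [canonEst_eq h hε, Nx, hy]⟩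
  · rintro _ ⟨ys, rfl⟩
    rw [canonEst_eq h hε]
    have : 0 ≤ (Nx I x ys : ℝ) / n := by positivity
    gcongr
    linarith

theorem isGreatest_range_canonEst (hn : 0 < n) (h : IsRPBD I b r lam) (hε : 0 < ε)
    (x : Fin v) :
    IsGreatest (Set.range (canonEst (n := n) I b r lam ε x))
      ((1 - hitIntercept b r lam ε) / hitSlope b r lam ε) := by
  have hA := hitSlope_pos h hε
  have hn' : (0 : ℝ) < n := by exact_mod_cast hn
  constructor
  · obtain ⟨y, hy⟩ : (Ix I x).Nonempty := by
      rw [← Finset.card_pos, h.2.2.2.2.1 x]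
      exact h.2.2.1.pos
    exact ⟨fun _ => y, by simp [canonEst_eq h hε, Nx, hy, hn'.ne']⟩
  · rintro _ ⟨ys, rfl⟩
    rw [canonEst_eq h hε]
    have h1 : (Nx I x ys : ℝ) ≤ n := by
      exact_mod_cast (Finset.card_filter_le _ _).trans (by simp)
    have : (Nx I x ys : ℝ) / n ≤ 1 := (div_le_one hn').2 h1
    gcongr

end Distribution

/-- Two block design schemes with parameters `(v,b,r,k,lam,ε)` and
`(v,b',r',k',lam',ε)` are marginally equivalent iff `k = k'`. -/
theorem block_design_marg_equiv_iff {v n b r k lam b' r' k' lam' : ℕ} (hn : 0 < n)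
    {Y Y' : Type*} [Fintype Y] [DecidableEq Y] [Fintype Y'] [DecidableEq Y']
    (I : Finset (Fin v × Y)) (I' : Finset (Fin v × Y'))
    (h : IsBlockDesign I b r k lam) (h' : IsBlockDesign I' b' r' k' lam')
    (ε : ℝ) (hε : 0 < ε) :
    MargEquiv n (mechQ I b r ε) (canonEst I b r lam ε)
        (mechQ I' b' r' ε) (canonEst I' b' r' lam' ε)
      ↔ k = k' := by
  have hv : (0 : ℝ) < v := by exact_mod_cast h.1.1
  have hk := hitSlope_add_mul_hitIntercept (ε := ε) h
  have hk' := hitSlope_add_mul_hitIntercept (ε := ε) h'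
  constructor
  · intro hequiv
    let x : Fin v := ⟨0, h.1.1⟩
    have hP : Pi.single x 1 ∈ simplex v :=
      ⟨fun y => (Pi.single_nonneg.2 zero_le_one : (0 : Fin v → ℝ) ≤ Pi.single x 1) y, by simp⟩
    have hrange : Set.range (canonEst (n := n) I b r lam ε x) =
        Set.range (canonEst (n := n) I' b' r' lam' ε x) := by
      ext t
      rw [← law_canonEst_ne_zero_iff h.1 hP, ← law_canonEst_ne_zero_iff h'.1 hP, hequiv _ hP]
    have hmin := (isLeast_range_canonEst (n := n) h.1 hε x).unique
      (hrange ▸ isLeast_range_canonEst h'.1 hε x)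
    have hmax := (isGreatest_range_canonEst hn h.1 hε x).unique
      (hrange ▸ isGreatest_range_canonEst hn h'.1 hε x)
    have hA := (hitSlope_pos h.1 hε).ne'
    have hA' := (hitSlope_pos h'.1 hε).ne'
    have hslope : hitSlope b r lam ε = hitSlope b' r' lam' ε := by
      apply inv_injective
      simp only [sub_div, neg_div, one_div] at hmin hmax
      linarith
    have hint : hitIntercept b r lam ε = hitIntercept b' r' lam' ε := by
      rw [hslope, div_left_inj' hA'] at hmin
      exact neg_injective hmin
    have : (k : ℝ) = k' := by rw [← hk, ← hk', hslope, hint]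
    exact_mod_cast this
  · rintro rfl
    have hslope : hitSlope b r lam ε = hitSlope b' r' lam' ε := by
      rw [hitSlope_eq h hε, hitSlope_eq h' hε]
    have hint : hitIntercept b r lam ε = hitIntercept b' r' lam' ε :=
      mul_left_cancel₀ hv.ne' (by linarith)
    intro P hP x t
    rw [law_canonEst h.1 hε hP, law_canonEst h'.1 hε hP, hslope, hint]

end
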